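/- arXiv:1208.5463 — 4 statements merged into one kernel-verified Lean document; each statement's English description precedes it below -/
import Mathlib

section
/- For all integers l ≥ 2 and m ≥ 1, the toughness of G(L⁽¹⁾,x,y,l,m) equals (l + 4m)/(2m + 1). -/
open SimpleGraph

/-- Number of connected components of the subgraph induced on the complement of `S`. -/
noncomputable def numComponents {V : Type} (G : SimpleGraph V) (S : Set V) : ℕ :=
  Nat.card (G.induce Sᶜ).ConnectedComponent

/-- `G` is `t`-tough: `|S| ≥ t · ω(G \ S)` for every vertex subset `S`
with `ω(G \ S) > 1`. -/
def IsTough {V : Type} (t : ℝ) (G : SimpleGraph V) : Prop :=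
  ∀ S : Finset V, 1 < numComponents G ↑S →
    t * (numComponents G ↑S : ℝ) ≤ (S.card : ℝ)

/-- The toughness of `G` equals `t`: `t` is the greatest nonnegative real
for which `G` is `t`-tough. -/
def HasToughness {V : Type} (G : SimpleGraph V) (t : ℝ) : Prop :=
  IsGreatest {s : ℝ | 0 ≤ s ∧ IsTough s G} t

/-- A Hamiltonian cycle: a cycle whose support contains every vertex. -/
def IsHamCycle {V : Type} {G : SimpleGraph V} {v : V} (p : G.Walk v v) : Prop :=
  p.IsCycle ∧ ∀ u, u ∈ p.support

/-- A graph is Hamiltonian if it contains a Hamiltonian cycle. -/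
def IsHam {V : Type} (G : SimpleGraph V) : Prop :=
  ∃ (v : V) (p : G.Walk v v), IsHamCycle p

/-- `x` and `y` are connected by a Hamilton path of `G`: a path with endpoints
`x` and `y` containing every vertex of `G`. -/
def HamConnected {V : Type} (G : SimpleGraph V) (x y : V) : Prop :=
  ∃ p : G.Walk x y, p.IsPath ∧ ∀ v, v ∈ p.support

/-- `L⁽¹⁾`: the 8-cycle `w₁w₂…w₈w₁` (here `wᵢ = i - 1`) together with the
edges `w₂w₄, w₄w₆, w₆w₈, w₂w₈`; `x = w₁ = 0`, `y = w₅ = 4`. -/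
def L1 : SimpleGraph (Fin 8) := SimpleGraph.fromEdgeSet
  {s(0,1), s(1,2), s(2,3), s(3,4), s(4,5), s(5,6), s(6,7), s(7,0),
   s(1,3), s(3,5), s(5,7), s(1,7)}

/-- `L⁽²⁾`: obtained from `L⁽¹⁾` by deleting `w₁w₂, w₂w₈` and identifying `w₂`
with `w₈`.  Vertices `w₁, w, w₃, w₄, w₅, w₆, w₇` are `0, 1, 2, 3, 4, 5, 6`;
`x = w₁ = 0`, `y = w₅ = 4`. -/
def L2 : SimpleGraph (Fin 7) := SimpleGraph.fromEdgeSet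
  {s(0,1), s(1,2), s(2,3), s(3,4), s(4,5), s(5,6), s(6,1),
   s(1,3), s(3,5), s(5,1)}

/-- `L⁽³⁾`: obtained from `L⁽¹⁾` by adding a new vertex `w₉ = 8` and the edges
`w₄w₉, w₆w₉`; `x = w₁ = 0`, `y = w₅ = 4`. -/
def L3 : SimpleGraph (Fin 9) := SimpleGraph.fromEdgeSet
  {s(0,1), s(1,2), s(2,3), s(3,4), s(4,5), s(5,6), s(6,7), s(7,0),
   s(1,3), s(3,5), s(5,7), s(1,7), s(3,8), s(5,8)}

/-- `L⁽⁴⁾`: the triangle `w₁w₂w₃w₁` together with pendant vertices `w₄, w₅`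
and edges `w₁w₄, w₃w₅` (here `wᵢ = i - 1`); `x = w₄ = 3`, `y = w₅ = 4`. -/
def L4 : SimpleGraph (Fin 5) := SimpleGraph.fromEdgeSet
  {s(0,1), s(1,2), s(2,0), s(0,3), s(2,4)}

/-- A building block: a graph together with two distinguished vertices. -/
structure Block where
  V : Type
  G : SimpleGraph V
  x : V
  y : V

/-- The graph `G(L,x,y,l,m)` (allowing a different block for each of the `m`
copies): disjoint copies `L₁, …, Lₘ` of the blocks, all possible edges between
pairs of vertices in `{x₁, …, xₘ, y₁, …, yₘ}`, joined with a complete graph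
`T = Kₗ`. -/
def GGen {m : ℕ} (l : ℕ) (B : Fin m → Block) :
    SimpleGraph (Fin l ⊕ Σ i, (B i).V) :=
  SimpleGraph.fromRel fun a b =>
    (∃ t, a = Sum.inl t) ∨ (∃ t, b = Sum.inl t) ∨
    (∃ (i : Fin m) (u v : (B i).V),
      a = Sum.inr ⟨i, u⟩ ∧ b = Sum.inr ⟨i, v⟩ ∧ (B i).G.Adj u v) ∨
    (∃ p q : Σ i, (B i).V, a = Sum.inr p ∧ b = Sum.inr q ∧
      (p.2 = (B p.1).x ∨ p.2 = (B p.1).y) ∧ (q.2 = (B q.1).x ∨ q.2 = (B q.1).y))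

def blockL1 : Block := ⟨Fin 8, L1, 0, 4⟩
def blockL2 : Block := ⟨Fin 7, L2, 0, 4⟩
def blockL3 : Block := ⟨Fin 9, L3, 0, 4⟩
def blockL4 : Block := ⟨Fin 5, L4, 3, 4⟩

/-- In one copy of `L1`, with the deleted vertices `S` and a labelling `f` of the vertices that is
constant along the surviving edges, each label missing at `0` and `4` costs two deleted vertices,
and there are at most two such labels. -/
theorem L1_card_labels {K : Type*} [DecidableEq K] (S : Finset (Fin 8)) (f : Fin 8 → K)
    (hf : ∀ u v, u ∉ S → v ∉ S → L1.Adj u v → f u = f v) (P : Finset K)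
    (hP : ∀ k ∈ P, ∃ u, u ∉ S ∧ f u = k)
    (h0 : 0 ∉ S → f 0 ∉ P) (h4 : 4 ∉ S → f 4 ∉ P) :
    P.card ≤ 2 ∧ 2 * P.card ≤ S.card := by
  have hcard : S.card = ∑ i : Fin 8, if i ∈ S then 1 else 0 := by simp
  rw [Fin.sum_univ_eight] at hcard
  have e01 : 0 ∉ S → 1 ∉ S → f 0 = f 1 := fun a b => hf _ _ a b (by simp [L1])
  have e12 : 1 ∉ S → 2 ∉ S → f 1 = f 2 := fun a b => hf _ _ a b (by simp [L1])
  have e23 : 2 ∉ S → 3 ∉ S → f 2 = f 3 := fun a b => hf _ _ a b (by simp [L1])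
  have e34 : 3 ∉ S → 4 ∉ S → f 3 = f 4 := fun a b => hf _ _ a b (by simp [L1])
  have e45 : 4 ∉ S → 5 ∉ S → f 4 = f 5 := fun a b => hf _ _ a b (by simp [L1])
  have e56 : 5 ∉ S → 6 ∉ S → f 5 = f 6 := fun a b => hf _ _ a b (by simp [L1])
  have e67 : 6 ∉ S → 7 ∉ S → f 6 = f 7 := fun a b => hf _ _ a b (by simp [L1])
  have e70 : 7 ∉ S → 0 ∉ S → f 7 = f 0 := fun a b => hf _ _ a b (by simp [L1])
  have e13 : 1 ∉ S → 3 ∉ S → f 1 = f 3 := fun a b => hf _ _ a b (by simp [L1])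
  have e35 : 3 ∉ S → 5 ∉ S → f 3 = f 5 := fun a b => hf _ _ a b (by simp [L1])
  have e57 : 5 ∉ S → 7 ∉ S → f 5 = f 7 := fun a b => hf _ _ a b (by simp [L1])
  have e17 : 1 ∉ S → 7 ∉ S → f 1 = f 7 := fun a b => hf _ _ a b (by simp [L1])
  clear hf
  set A := P.filter (fun k => (1 ∉ S ∧ f 1 = k) ∨ (2 ∉ S ∧ f 2 = k) ∨ (3 ∉ S ∧ f 3 = k)) with hA
  set B := P.filter (fun k => (5 ∉ S ∧ f 5 = k) ∨ (6 ∉ S ∧ f 6 = k) ∨ (7 ∉ S ∧ f 7 = k)) with hB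
  have hAB : P = A ∪ B := by
    ext k
    simp only [hA, hB, Finset.mem_union, Finset.mem_filter]
    refine ⟨fun hk => ?_, fun h => h.elim And.left And.left⟩
    obtain ⟨u, hu, rfl⟩ := hP k hk
    obtain rfl | rfl | rfl | rfl | rfl | rfl | rfl | rfl :
        u = 0 ∨ u = 4 ∨ u = 1 ∨ u = 2 ∨ u = 3 ∨ u = 5 ∨ u = 6 ∨ u = 7 := by omega
    · exact absurd hk (h0 hu)
    · exact absurd hk (h4 hu)
    · exact Or.inl ⟨hk, Or.inl ⟨hu, rfl⟩⟩
    · exact Or.inl ⟨hk, Or.inr (Or.inl ⟨hu, rfl⟩)⟩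
    · exact Or.inl ⟨hk, Or.inr (Or.inr ⟨hu, rfl⟩)⟩
    · exact Or.inr ⟨hk, Or.inl ⟨hu, rfl⟩⟩
    · exact Or.inr ⟨hk, Or.inr (Or.inl ⟨hu, rfl⟩)⟩
    · exact Or.inr ⟨hk, Or.inr (Or.inr ⟨hu, rfl⟩)⟩
  have hA1 : A.card ≤ 1 := by
    rw [Finset.card_le_one]
    simp only [hA, Finset.mem_filter]
    grind
  have hB1 : B.card ≤ 1 := by
    rw [Finset.card_le_one]
    simp only [hB, Finset.mem_filter]
    grind
  have hU : P.card ≤ A.card + B.card := hAB ▸ Finset.card_union_le A B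
  refine ⟨by omega, ?_⟩
  have hAS : 0 < A.card → (0 ∈ S ∨ 1 ∈ S) ∧ (3 ∈ S ∨ 4 ∈ S) := by
    rw [Finset.card_pos]
    rintro ⟨k, hk⟩
    simp only [hA, Finset.mem_filter] at hk
    grind
  have hBS : 0 < B.card → (0 ∈ S ∨ 7 ∈ S) ∧ (5 ∈ S ∨ 4 ∈ S) := by
    rw [Finset.card_pos]
    rintro ⟨k, hk⟩
    simp only [hB, Finset.mem_filter] at hk
    grind
  have hS2 : 0 < P.card → 2 ≤ S.card := by
    intro h
    rcases (by omega : 0 < A.card ∨ 0 < B.card) with h | h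
    · obtain ⟨h1 | h1, h2 | h2⟩ := hAS h <;> simp only [h1, h2, if_true] at hcard <;> omega
    · obtain ⟨h1 | h1, h2 | h2⟩ := hBS h <;> simp only [h1, h2, if_true] at hcard <;> omega
  rcases (by omega : P.card = 0 ∨ P.card = 1 ∨ P.card = 2) with h | h | h
  · omega
  · have := hS2 (by omega)
    omega
  · obtain ⟨a, ha⟩ : A.Nonempty := Finset.card_pos.1 (by omega)
    obtain ⟨b, hb⟩ : B.Nonempty := Finset.card_pos.1 (by omega)
    have hab : a ≠ b := by
      rintro rfl
      have hPa : P ⊆ {a} := by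
        rw [hAB]
        intro k hk
        rw [Finset.mem_singleton]
        rcases Finset.mem_union.1 hk with hk | hk
        · exact Finset.card_le_one.1 hA1 _ hk _ ha
        · exact Finset.card_le_one.1 hB1 _ hk _ hb
      have := Finset.card_le_card hPa
      rw [Finset.card_singleton] at this
      omega
    have h17 : 1 ∈ S ∨ 7 ∈ S := by
      simp only [hA, hB, Finset.mem_filter] at ha hb
      grind
    have h35 : 3 ∈ S ∨ 5 ∈ S := by
      simp only [hA, hB, Finset.mem_filter] at ha hb
      grind
    obtain ⟨h01, h34⟩ := hAS (by omega)
    obtain ⟨h07, h54⟩ := hBS (by omega)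
    have h017 : 2 ≤ (if 0 ∈ S then 1 else 0) + (if 1 ∈ S then 1 else 0) +
        (if 7 ∈ S then 1 else 0) := by
      clear * - h17 h01 h07
      split_ifs <;> first | omega | tauto
    have h345 : 2 ≤ (if 3 ∈ S then 1 else 0) + (if 4 ∈ S then 1 else 0) +
        (if 5 ∈ S then 1 else 0) := by
      clear * - h35 h34 h54
      split_ifs <;> first | omega | tauto
    omega

/-- `G(L⁽¹⁾,x,y,l,m)`, on a vertex type without blocks. -/
def GL1 (l m : ℕ) : SimpleGraph (Fin l ⊕ Σ _ : Fin m, Fin 8) :=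
  GGen l (fun _ : Fin m => blockL1)

theorem GL1_adj_inl {l m : ℕ} (t : Fin l) {v : Fin l ⊕ Σ _ : Fin m, Fin 8} (h : Sum.inl t ≠ v) :
    (GL1 l m).Adj (Sum.inl t) v :=
  ⟨h, Or.inl (Or.inl ⟨t, rfl⟩)⟩

theorem GL1_adj_of_L1_adj {l m : ℕ} (i : Fin m) {u v : Fin 8} (h : L1.Adj u v) :
    (GL1 l m).Adj (Sum.inr ⟨i, u⟩) (Sum.inr ⟨i, v⟩) :=
  ⟨fun e => h.ne (by cases e; rfl), Or.inl (Or.inr (Or.inr (Or.inl ⟨i, u, v, rfl, rfl, h⟩)))⟩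

theorem GL1_adj_of_ends {l m : ℕ} {i j : Fin m} {u v : Fin 8} (hu : u = 0 ∨ u = 4)
    (hv : v = 0 ∨ v = 4) (h : (⟨i, u⟩ : Σ _ : Fin m, Fin 8) ≠ ⟨j, v⟩) :
    (GL1 l m).Adj (Sum.inr ⟨i, u⟩) (Sum.inr ⟨j, v⟩) :=
  ⟨fun e => h (Sum.inr.inj e), Or.inl (Or.inr (Or.inr (Or.inr ⟨⟨i, u⟩, ⟨j, v⟩, rfl, rfl, hu, hv⟩)))⟩

theorem GL1_adj_inr {l m : ℕ} {p q : Σ _ : Fin m, Fin 8}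
    (h : (GL1 l m).Adj (Sum.inr p) (Sum.inr q)) :
    (p.1 = q.1 ∧ L1.Adj p.2 q.2) ∨ ((p.2 = 0 ∨ p.2 = 4) ∧ (q.2 = 0 ∨ q.2 = 4)) := by
  obtain ⟨-, h | h⟩ := h
  · rcases h with ⟨t, ht⟩ | ⟨t, ht⟩ | ⟨i, u, v, hp, hq, h⟩ | ⟨p', q', hp, hq, h⟩
    · cases ht
    · cases ht
    · cases hp
      cases hq
      exact Or.inl ⟨rfl, h⟩
    · cases hp
      cases hq
      exact Or.inr h
  · rcases h with ⟨t, ht⟩ | ⟨t, ht⟩ | ⟨i, u, v, hp, hq, h⟩ | ⟨p', q', hp, hq, h⟩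
    · cases ht
    · cases ht
    · cases hp
      cases hq
      exact Or.inl ⟨rfl, h.symm⟩
    · cases hp
      cases hq
      exact Or.inr h.symm

theorem card_eq_add_sum_slices {l m : ℕ} (S : Finset (Fin l ⊕ Σ _ : Fin m, Fin 8))
    (hS : ∀ t, Sum.inl t ∈ S) :
    S.card = l + ∑ i : Fin m, (Finset.univ.filter fun u => Sum.inr ⟨i, u⟩ ∈ S).card := by
  have h : S.card = ∑ v, if v ∈ S then 1 else 0 := by simp
  rw [h, Fintype.sum_sum_type, Fintype.sum_sigma]
  simp [hS]

/-- If `S` disconnects `G(L⁽¹⁾,x,y,l,m)`, then `S` contains all of `T`. -/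
theorem inl_mem_of_one_lt_numComponents {l m : ℕ} {S : Finset (Fin l ⊕ Σ _ : Fin m, Fin 8)}
    (hS : 1 < numComponents (GL1 l m) ↑S) (t : Fin l) : Sum.inl t ∈ S := by
  by_contra ht
  have hle : numComponents (GL1 l m) ↑S ≤ 1 := by
    rw [numComponents, Finite.card_le_one_iff_subsingleton]
    suffices h : ∀ c : ((GL1 l m).induce (↑S : Set _)ᶜ).ConnectedComponent,
        c = connectedComponentMk _ ⟨Sum.inl t, by simpa using ht⟩ from
      ⟨fun a b => (h a).trans (h b).symm⟩
    refine ConnectedComponent.ind fun v => ?_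
    rw [ConnectedComponent.eq]
    by_cases hv : Sum.inl t = v.1
    · have : v = ⟨Sum.inl t, by simpa using ht⟩ := Subtype.ext hv.symm
      rw [this]
    · exact (Adj.reachable (induce_adj.2 (GL1_adj_inl t hv))).symm
  omega

theorem exists_numComponents_le {l m : ℕ} {S : Finset (Fin l ⊕ Σ _ : Fin m, Fin 8)}
    (hS : 1 < numComponents (GL1 l m) ↑S) :
    ∃ c : ℕ, c ≤ 2 * m ∧ l + 2 * c ≤ S.card ∧ numComponents (GL1 l m) ↑S ≤ c + 1 := by
  classical
  have hT := inl_mem_of_one_lt_numComponents hS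
  let H := (GL1 l m).induce (↑S : Set _)ᶜ
  have : Fintype H.ConnectedComponent := Fintype.ofFinite _
  have hnum : numComponents (GL1 l m) ↑S = Fintype.card H.ConnectedComponent :=
    Nat.card_eq_fintype_card
  have : Nonempty H.ConnectedComponent := Fintype.card_pos_iff.1 (by omega)
  inhabit H.ConnectedComponent
  let f : (Fin l ⊕ Σ _ : Fin m, Fin 8) → H.ConnectedComponent := fun v =>
    if h : v ∉ S then H.connectedComponentMk ⟨v, by simpa using h⟩ else default
  have hf : ∀ u v, u ∉ S → v ∉ S → (GL1 l m).Adj u v → f u = f v := by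
    intro u v hu hv huv
    simp only [f, hu, hv, not_false_eq_true, dif_pos]
    exact ConnectedComponent.sound (Adj.reachable (G := H) huv)
  have hsurj : ∀ k, ∃ v, v ∉ S ∧ f v = k := by
    refine ConnectedComponent.ind fun v => ⟨v.1, fun h => v.2 h, ?_⟩
    have : v.1 ∉ S := fun h => v.2 h
    simp [f, this]
  let E : Finset H.ConnectedComponent := Finset.univ.filter fun k =>
    ∃ (i : Fin m) (u : Fin 8), (u = 0 ∨ u = 4) ∧ Sum.inr ⟨i, u⟩ ∉ S ∧ f (Sum.inr ⟨i, u⟩) = k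
  let P : Fin m → Finset H.ConnectedComponent := fun i => Finset.univ.filter fun k =>
    k ∉ E ∧ ∃ u : Fin 8, Sum.inr ⟨i, u⟩ ∉ S ∧ f (Sum.inr ⟨i, u⟩) = k
  have hE : E.card ≤ 1 := by
    rw [Finset.card_le_one]
    intro a ha b hb
    obtain ⟨i, u, hu, huS, rfl⟩ := (Finset.mem_filter.1 ha).2
    obtain ⟨j, v, hv, hvS, rfl⟩ := (Finset.mem_filter.1 hb).2
    by_cases h : (⟨i, u⟩ : Σ _ : Fin m, Fin 8) = ⟨j, v⟩
    · rw [h]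
    · exact hf _ _ huS hvS (GL1_adj_of_ends hu hv h)
  have hcover : (Finset.univ : Finset H.ConnectedComponent) ⊆ E ∪ Finset.univ.biUnion P := by
    intro k _
    by_cases hk : k ∈ E
    · exact Finset.mem_union_left _ hk
    · obtain ⟨t | ⟨i, u⟩, hv, hvk⟩ := hsurj k
      · exact absurd (hT t) hv
      · exact Finset.mem_union_right _ (Finset.mem_biUnion.2
          ⟨i, Finset.mem_univ _, Finset.mem_filter.2 ⟨Finset.mem_univ _, hk, u, hv, hvk⟩⟩)
  have hP : ∀ i, (P i).card ≤ 2 ∧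
      2 * (P i).card ≤ (Finset.univ.filter fun u => Sum.inr ⟨i, u⟩ ∈ S).card := by
    intro i
    have hend : ∀ u : Fin 8, (u = 0 ∨ u = 4) →
        u ∉ (Finset.univ.filter fun u => Sum.inr ⟨i, u⟩ ∈ S) → f (Sum.inr ⟨i, u⟩) ∉ P i := by
      intro u hu huS hmem
      exact (Finset.mem_filter.1 hmem).2.1
        (Finset.mem_filter.2 ⟨Finset.mem_univ _, i, u, hu, by simpa using huS, rfl⟩)
    refine L1_card_labels _ (fun u => f (Sum.inr ⟨i, u⟩)) ?_ (P i) ?_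
      (hend 0 (Or.inl rfl)) (hend 4 (Or.inr rfl))
    · intro u v hu hv huv
      exact hf _ _ (by simpa using hu) (by simpa using hv) (GL1_adj_of_L1_adj i huv)
    · intro k hk
      obtain ⟨u, hu, huk⟩ := (Finset.mem_filter.1 hk).2.2
      exact ⟨u, by simpa using hu, huk⟩
  refine ⟨∑ i, (P i).card, ?_, ?_, ?_⟩
  · calc ∑ i, (P i).card ≤ ∑ _i : Fin m, 2 := Finset.sum_le_sum fun i _ => (hP i).1
      _ = 2 * m := by simp [mul_comm]
  · rw [card_eq_add_sum_slices S hT, Finset.mul_sum]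
    exact Nat.add_le_add_left (Finset.sum_le_sum fun i _ => (hP i).2) l
  · have h1 := Finset.card_le_card hcover
    have h2 := Finset.card_union_le E (Finset.univ.biUnion P)
    have h3 : (Finset.univ.biUnion P).card ≤ ∑ i, (P i).card := Finset.card_biUnion_le
    rw [Finset.card_univ] at h1
    omega

open scoped Classical in
/-- The set `T` together with the vertices `w₂, w₄, w₆, w₈` of every copy. -/
noncomputable def GL1Cut (l m : ℕ) : Finset (Fin l ⊕ Σ _ : Fin m, Fin 8) :=
  Finset.univ.filter (Sum.elim (fun _ => True) fun p => p.2 = 1 ∨ p.2 = 3 ∨ p.2 = 5 ∨ p.2 = 7)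

theorem inr_mem_GL1Cut {l m : ℕ} (p : Σ _ : Fin m, Fin 8) :
    Sum.inr p ∈ GL1Cut l m ↔ p.2 = 1 ∨ p.2 = 3 ∨ p.2 = 5 ∨ p.2 = 7 := by
  simp [GL1Cut]

theorem inl_mem_GL1Cut {l m : ℕ} (t : Fin l) : Sum.inl t ∈ GL1Cut l m := by
  simp [GL1Cut]

theorem card_GL1Cut (l m : ℕ) : (GL1Cut l m).card = l + 4 * m := by
  rw [card_eq_add_sum_slices _ inl_mem_GL1Cut]
  simp only [inr_mem_GL1Cut]
  have h : (Finset.univ.filter fun u : Fin 8 => u = 1 ∨ u = 3 ∨ u = 5 ∨ u = 7).card = 4 := by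
    decide
  simp [h, mul_comm]

theorem L1_adj_odd {u v : Fin 8} (h : L1.Adj u v) :
    (u = 1 ∨ u = 3 ∨ u = 5 ∨ u = 7) ∨ (v = 1 ∨ v = 3 ∨ v = 5 ∨ v = 7) := by
  simp only [L1, fromEdgeSet_adj, Set.mem_insert_iff, Set.mem_singleton_iff, Sym2.eq_iff] at h
  tauto

theorem le_numComponents_GL1Cut {l m : ℕ} (hm : 1 ≤ m) :
    2 * m + 1 ≤ numComponents (GL1 l m) ↑(GL1Cut l m) := by
  let H := (GL1 l m).induce (↑(GL1Cut l m) : Set _)ᶜ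
  let φ : (Fin l ⊕ Σ _ : Fin m, Fin 8) → Option (Fin m × Bool) :=
    Sum.elim (fun _ => none) fun p =>
      if p.2 = 2 then some (p.1, false) else if p.2 = 6 then some (p.1, true) else none
  have hadj : ∀ u v, H.Adj u v → φ u.1 = φ v.1 := by
    rintro ⟨s | ⟨i, u⟩, hu⟩ ⟨t | ⟨j, v⟩, hv⟩ huv
    · exact absurd (inl_mem_GL1Cut s) hu
    · exact absurd (inl_mem_GL1Cut s) hu
    · exact absurd (inl_mem_GL1Cut t) hv
    · replace hu := (inr_mem_GL1Cut (l := l) _).not.1 hu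
      replace hv := (inr_mem_GL1Cut (l := l) _).not.1 hv
      rcases GL1_adj_inr huv with ⟨h, h'⟩ | ⟨h | h, h' | h'⟩
      · exact absurd (L1_adj_odd h') (not_or.2 ⟨hu, hv⟩)
      all_goals
        simp only at h h'
        subst h h'
        simp [φ]
  have hreach : ∀ u v, H.Reachable u v → φ u.1 = φ v.1 := by
    rintro u v ⟨p⟩
    induction p with
    | nil => rfl
    | cons h _ ih => exact (hadj _ _ h).trans ih
  let ψ : H.ConnectedComponent → Option (Fin m × Bool) :=
    Quot.lift (fun v => φ v.1) hreach
  have hval : ∀ (i : Fin m) (u : Fin 8), ¬(u = 1 ∨ u = 3 ∨ u = 5 ∨ u = 7) →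
      ∃ k, ψ k = φ (Sum.inr ⟨i, u⟩) := fun i u hu =>
    ⟨H.connectedComponentMk ⟨Sum.inr ⟨i, u⟩, (inr_mem_GL1Cut (l := l) _).not.2 hu⟩, rfl⟩
  have hψ : Function.Surjective ψ := by
    rintro (_ | ⟨i, _ | _⟩)
    · exact hval ⟨0, hm⟩ 0 (by decide)
    · exact hval i 2 (by decide)
    · exact hval i 6 (by decide)
  have h := Nat.card_le_card_of_surjective ψ hψ
  have hc : Nat.card (Option (Fin m × Bool)) = 2 * m + 1 := by
    simp [mul_comm]
  rw [hc] at h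
  exact h

/-- For `l ≥ 2` and `m ≥ 1`,
`τ(G(L⁽¹⁾,x,y,l,m)) = (l + 4m)/(2m + 1)`. -/
theorem toughness_GGen_L1 (l m : ℕ) (hl : 2 ≤ l) (hm : 1 ≤ m) :
    HasToughness (GGen l (fun _ : Fin m => blockL1))
      (((l : ℝ) + 4 * m) / (2 * m + 1)) := by
  change HasToughness (GL1 l m) _
  refine ⟨⟨by positivity, fun S hS => ?_⟩, fun s hs => ?_⟩
  · obtain ⟨c, hc, hcard, hnum⟩ := exists_numComponents_le hS
    have hl' : (2 : ℝ) ≤ l := by exact_mod_cast hl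
    have hc' : (c : ℝ) ≤ 2 * m := by exact_mod_cast hc
    have hcard' : (l : ℝ) + 2 * c ≤ S.card := by exact_mod_cast hcard
    have hnum' : (numComponents (GL1 l m) ↑S : ℝ) ≤ c + 1 := by exact_mod_cast hnum
    rw [div_mul_eq_mul_div, div_le_iff₀ (by positivity)]
    calc ((l : ℝ) + 4 * m) * (numComponents (GL1 l m) ↑S : ℝ)
        ≤ (l + 4 * m) * (c + 1) := by gcongr
      _ ≤ (l + 2 * c) * (2 * m + 1) := by
        nlinarith [mul_nonneg (sub_nonneg.2 hl') (sub_nonneg.2 hc')]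
      _ ≤ S.card * (2 * m + 1) := by gcongr
  · obtain ⟨hs0, hs⟩ := hs
    have hnum := le_numComponents_GL1Cut (l := l) hm
    have h := hs (GL1Cut l m) (by omega)
    rw [card_GL1Cut] at h
    have hnum' : (2 * m + 1 : ℝ) ≤ numComponents (GL1 l m) ↑(GL1Cut l m) := by
      exact_mod_cast hnum
    rw [le_div_iff₀ (by positivity)]
    calc s * (2 * m + 1) ≤ s * numComponents (GL1 l m) ↑(GL1Cut l m) := by gcongr
      _ ≤ l + 4 * m := by exact_mod_cast h
end

section
/- Let a, b be integers with b < a and 2a < 3b − 2 (equivalently 1 < a/b < 3/2 − 1/b). Let H be the graph on pairwise disjoint vertex sets V₁ = {x₁,…,x_{a−b+1}}, V₂ = {y₁,…,y_b}, V₃ = {z₁,…,z_b}, in which every xᵢ is adjacent to all other vertices, every zᵢ is adjacent to every other z_j and to the vertex yᵢ with the same subscript, and there are no other edges. Then H is nonhamiltonian and its toughness equals a/b. -/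
open SimpleGraph

/-- The graph `H` on vertex sets `V₁` (size `a - b + 1`), `V₂` (size `b`),
`V₃` (size `b`): every vertex of `V₁` is adjacent to all other vertices,
every `zᵢ ∈ V₃` is adjacent to every other `z_j` and to `yᵢ ∈ V₂`, and
there are no other edges. -/
def Hgraph (a b : ℕ) : SimpleGraph (Fin (a - b + 1) ⊕ Fin b ⊕ Fin b) :=
  SimpleGraph.fromRel fun u v =>
    match u, v with
    | Sum.inl _, _ => True
    | _, Sum.inl _ => True
    | Sum.inr (Sum.inr _), Sum.inr (Sum.inr _) => True
    | Sum.inr (Sum.inr i), Sum.inr (Sum.inl j) => i = j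
    | Sum.inr (Sum.inl i), Sum.inr (Sum.inr j) => i = j
    | _, _ => False

lemma Hgraph_adj_inl {a b : ℕ} (x : Fin (a - b + 1))
    (v : Fin (a - b + 1) ⊕ Fin b ⊕ Fin b) :
    (Hgraph a b).Adj (Sum.inl x) v ↔ Sum.inl x ≠ v := by
  simp [Hgraph]

lemma Hgraph_adj_y_z {a b : ℕ} (i j : Fin b) :
    (Hgraph a b).Adj (Sum.inr (Sum.inl i)) (Sum.inr (Sum.inr j)) ↔ i = j := by
  simp [Hgraph, eq_comm]

lemma Hgraph_not_adj_y_y {a b : ℕ} (i j : Fin b) :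
    ¬ (Hgraph a b).Adj (Sum.inr (Sum.inl i)) (Sum.inr (Sum.inl j)) := by
  simp [Hgraph]

lemma Hgraph_adj_z_z {a b : ℕ} (i j : Fin b) :
    (Hgraph a b).Adj (Sum.inr (Sum.inr i)) (Sum.inr (Sum.inr j)) ↔ i ≠ j := by
  simp [Hgraph]

/-- In a Hamiltonian cycle every `yᵢ` has a neighbour in `V₁`, while each vertex of `V₁` serves
at most two of them. -/
lemma le_two_mul_of_isHam_Hgraph {a b : ℕ} (h : IsHam (Hgraph a b)) :
    b ≤ 2 * (a - b + 1) := by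
  obtain ⟨v, p, hp, hs⟩ := h
  have hx (i : Fin b) : ∃ x : Fin (a - b + 1),
      p.toSubgraph.Adj (Sum.inr (Sum.inl i)) (Sum.inl x) := by
    have h2 := hp.ncard_neighborSet_toSubgraph_eq_two (hs (Sum.inr (Sum.inl i)))
    obtain ⟨w, hw, hne⟩ := Set.exists_ne_of_one_lt_ncard
      (by omega : 1 < (p.toSubgraph.neighborSet (Sum.inr (Sum.inl i))).ncard)
      (Sum.inr (Sum.inr i))
    rw [Subgraph.mem_neighborSet] at hw
    rcases w with x | j | j
    · exact ⟨x, hw⟩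
    · exact absurd hw.adj_sub (Hgraph_not_adj_y_y i j)
    · exact absurd (by rw [(Hgraph_adj_y_z i j).1 hw.adj_sub]) hne
  choose f hf using hx
  have := Finset.card_le_mul_card_image_of_maps_to (f := f) (s := Finset.univ)
    (t := Finset.univ) (fun _ _ => Finset.mem_univ _) 2 (fun x _ => by
      have h2 := hp.ncard_neighborSet_toSubgraph_eq_two (hs (Sum.inl x))
      rw [← h2, ← Set.ncard_coe_finset]
      refine Set.ncard_le_ncard_of_injOn (fun i => Sum.inr (Sum.inl i)) ?_ ?_
        (Set.toFinite _)
      · intro i hi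
        have hi : f i = x := by simpa using hi
        exact hi ▸ (hf i).symm
      · intro i _ j _ hij
        simpa using hij)
  simpa using this

/-- If vertices with the same label are always in the same component of `G \ S`, then there are
at most as many components as labels. -/
lemma numComponents_le_card {V α : Type} {G : SimpleGraph V} {S : Set V} (f : V → α)
    (T : Finset α) (hT : ∀ v ∉ S, f v ∈ T)
    (hf : ∀ v w : ↥(Sᶜ), f v = f w → (G.induce Sᶜ).Reachable v w) :
    numComponents G S ≤ T.card := by
  have hinj : Function.Injective (fun C : (G.induce Sᶜ).ConnectedComponent =>
      (⟨f C.out, hT _ C.out.2⟩ : T)) := by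
    intro C D h
    have := hf _ _ (congrArg Subtype.val h)
    rw [← C.out_eq, ← D.out_eq]
    exact ConnectedComponent.eq.2 this
  simpa [numComponents] using Nat.card_le_card_of_injective _ hinj

lemma inl_mem_of_one_lt_numComponents_s13 {a b : ℕ} {S : Set (Fin (a - b + 1) ⊕ Fin b ⊕ Fin b)}
    (h : 1 < numComponents (Hgraph a b) S) (x : Fin (a - b + 1)) : Sum.inl x ∈ S := by
  by_contra hx
  have key (v : ↥(Sᶜ)) : ((Hgraph a b).induce Sᶜ).Reachable ⟨Sum.inl x, hx⟩ v := by
    by_cases hv : (⟨Sum.inl x, hx⟩ : ↥(Sᶜ)) = v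
    · rw [hv]
    · exact Adj.reachable ((Hgraph_adj_inl x v.1).2 fun h => hv (Subtype.ext h))
  have := numComponents_le_card (G := Hgraph a b) (S := S) (fun _ => ()) {()} (by simp)
    (fun v w _ => (key v).symm.trans (key w))
  simp at this
  omega

/-- The subscript of a vertex in `V₂ ∪ V₃`; vertices of `V₁` get `none`. -/
def HgraphIndex {a b : ℕ} : Fin (a - b + 1) ⊕ Fin b ⊕ Fin b → Option (Fin b) :=
  Sum.elim (fun _ => none) (Sum.elim some some)

lemma numComponents_Hgraph_le {a b : ℕ} {S : Set (Fin (a - b + 1) ⊕ Fin b ⊕ Fin b)}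
    (hS : ∀ x, Sum.inl x ∈ S) : numComponents (Hgraph a b) S ≤ b := by
  have := numComponents_le_card (G := Hgraph a b) (S := S) HgraphIndex
    (Finset.univ.map Function.Embedding.some) ?_ ?_
  · simpa using this
  · rintro (x | i | i) hv
    · exact absurd (hS x) hv
    all_goals simp [HgraphIndex]
  · rintro ⟨x | i | i, hv⟩ ⟨y | j | j, hw⟩ h
    any_goals exact absurd (hS _) hv
    any_goals exact absurd (hS _) hw
    all_goals
      obtain rfl : i = j := by simpa [HgraphIndex] using h
    · rfl
    · exact Adj.reachable ((Hgraph_adj_y_z i i).2 rfl)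
    · exact Adj.reachable ((Hgraph_adj_y_z i i).2 rfl).symm
    · rfl

open Classical in
lemma numComponents_Hgraph_le_card_add_one {a b : ℕ}
    {S : Set (Fin (a - b + 1) ⊕ Fin b ⊕ Fin b)} (hS : ∀ x, Sum.inl x ∈ S) :
    numComponents (Hgraph a b) S ≤
      (Finset.univ.filter fun i : Fin b => Sum.inr (Sum.inr i) ∈ S).card + 1 := by
  set K := Finset.univ.filter fun i : Fin b => Sum.inr (Sum.inr i) ∈ S
  have hz (i j : Fin b) (hi : Sum.inr (Sum.inr i) ∈ Sᶜ) (hj : Sum.inr (Sum.inr j) ∈ Sᶜ) :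
      ((Hgraph a b).induce Sᶜ).Reachable ⟨_, hi⟩ ⟨_, hj⟩ := by
    by_cases h : i = j
    · subst h; rfl
    · exact Adj.reachable ((Hgraph_adj_z_z i j).2 h)
  have hyz (i : Fin b) (hi : Sum.inr (Sum.inl i) ∈ Sᶜ) (hj : Sum.inr (Sum.inr i) ∈ Sᶜ) :
      ((Hgraph a b).induce Sᶜ).Reachable ⟨_, hi⟩ ⟨_, hj⟩ :=
    Adj.reachable ((Hgraph_adj_y_z i i).2 rfl)
  have := numComponents_le_card (G := Hgraph a b) (S := S)
    (fun v => (HgraphIndex v).filter (· ∈ K)) (Finset.insertNone K) ?_ ?_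
  · simpa using this
  · intro v _
    simp [Finset.mem_insertNone, Option.filter_eq_some_iff]
  · rintro ⟨x | i | i, hv⟩ ⟨y | j | j, hw⟩ h
    any_goals exact absurd (hS _) hv
    any_goals exact absurd (hS _) hw
    · by_cases hi : Sum.inr (Sum.inr i) ∈ S <;> by_cases hj : Sum.inr (Sum.inr j) ∈ S
      · obtain rfl : i = j := by simpa [HgraphIndex, Option.filter, K, hi, hj] using h
        rfl
      · simp [HgraphIndex, Option.filter, K, hi, hj] at h
      · simp [HgraphIndex, Option.filter, K, hi, hj] at h
      · exact ((hyz i hv hi).trans (hz i j hi hj)).trans (hyz j hw hj).symm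
    · by_cases hi : Sum.inr (Sum.inr i) ∈ S
      · have hj : Sum.inr (Sum.inr j) ∉ S := hw
        simp [HgraphIndex, Option.filter, K, hi, hj] at h
      · exact (hyz i hv hi).trans (hz i j hi hw)
    · by_cases hj : Sum.inr (Sum.inr j) ∈ S
      · have hi : Sum.inr (Sum.inr i) ∉ S := hv
        simp [HgraphIndex, Option.filter, K, hi, hj] at h
      · exact (hz i j hv hj).trans (hyz j hw hj).symm
    · exact hz i j hv hw

open Classical in
lemma Hgraph_card_add_le {a b : ℕ} (S : Finset (Fin (a - b + 1) ⊕ Fin b ⊕ Fin b))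
    (hS : ∀ x, Sum.inl x ∈ S) :
    a - b + 1 + (Finset.univ.filter fun i : Fin b => Sum.inr (Sum.inr i) ∈ S).card ≤ S.card := by
  have h : Finset.univ.disjSum ((∅ : Finset (Fin b)).disjSum
      (Finset.univ.filter fun i : Fin b => Sum.inr (Sum.inr i) ∈ S)) ⊆ S := by
    rintro (x | i | i) hv
    · exact hS x
    · simp at hv
    · simpa using hv
  simpa using Finset.card_le_card h

lemma isTough_Hgraph {a b : ℕ} (hba : b < a) (hb : 0 < b) :
    IsTough ((a : ℝ) / b) (Hgraph a b) := by
  classical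
  intro S hω
  have hS (x) : Sum.inl x ∈ S := inl_mem_of_one_lt_numComponents_s13 hω x
  have h1 := numComponents_Hgraph_le (a := a) (b := b) (S := (S : Set _)) hS
  have h2 := numComponents_Hgraph_le_card_add_one (a := a) (b := b) (S := (S : Set _)) hS
  have h3 := Hgraph_card_add_le S hS
  simp only [Finset.mem_coe] at h2
  have h4 : a + numComponents (Hgraph a b) S ≤ S.card + b := by omega
  set n := numComponents (Hgraph a b) S
  have hb' : (0 : ℝ) < b := by exact_mod_cast hb
  have hba' : (b : ℝ) < a := by exact_mod_cast hba
  have h1' : (n : ℝ) ≤ b := by exact_mod_cast h1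
  have h4' : (a : ℝ) + n ≤ S.card + b := by exact_mod_cast h4
  rw [div_mul_eq_mul_div, div_le_iff₀ hb']
  nlinarith [mul_nonneg (sub_nonneg.2 hba'.le) (sub_nonneg.2 h1')]

/-- The set `V₁ ∪ (V₃ \ {z_k})`. -/
def HgraphCut {a b : ℕ} (k : Fin b) : Finset (Fin (a - b + 1) ⊕ Fin b ⊕ Fin b) :=
  Finset.univ.disjSum ((∅ : Finset (Fin b)).disjSum (Finset.univ.erase k))

lemma card_HgraphCut {a b : ℕ} (hba : b ≤ a) (k : Fin b) :
    (HgraphCut (a := a) k).card = a := by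
  have := k.pos
  simp [HgraphCut]
  omega

lemma le_numComponents_HgraphCut {a b : ℕ} (k : Fin b) :
    b ≤ numComponents (Hgraph a b) ↑(HgraphCut (a := a) k) := by
  set S : Finset (Fin (a - b + 1) ⊕ Fin b ⊕ Fin b) := HgraphCut k with hS
  have hadj (v w : ↥((S : Set (Fin (a - b + 1) ⊕ Fin b ⊕ Fin b))ᶜ))
      (h : ((Hgraph a b).induce _).Adj v w) : HgraphIndex v.1 = HgraphIndex w.1 := by
    obtain ⟨v, hv⟩ := v
    obtain ⟨w, hw⟩ := w
    have h : (Hgraph a b).Adj v w := h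
    rcases v with x | i | i <;> rcases w with y | j | j <;>
      simp [hS, HgraphCut] at hv hw <;> simp [HgraphIndex]
    · exact absurd h (Hgraph_not_adj_y_y i j)
    · exact (Hgraph_adj_y_z i j).1 h
    · exact ((Hgraph_adj_y_z j i).1 h.symm).symm
    · rw [hv, hw]
  have hreach (v w : ↥((S : Set (Fin (a - b + 1) ⊕ Fin b ⊕ Fin b))ᶜ))
      (h : ((Hgraph a b).induce _).Reachable v w) : HgraphIndex v.1 = HgraphIndex w.1 := by
    obtain ⟨p⟩ := h
    induction p with
    | nil => rfl
    | cons h _ ih => exact (hadj _ _ h).trans ih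
  have hy (i : Fin b) :
      Sum.inr (Sum.inl i) ∈ (S : Set (Fin (a - b + 1) ⊕ Fin b ⊕ Fin b))ᶜ := by
    simp [hS, HgraphCut]
  have hinj : Function.Injective
      (fun i : Fin b => ((Hgraph a b).induce _).connectedComponentMk ⟨_, hy i⟩) := by
    intro i j h
    simpa [HgraphIndex] using hreach _ _ (ConnectedComponent.eq.1 h)
  simpa [numComponents] using Nat.card_le_card_of_injective _ hinj

/-- For integers `b < a` with `2a < 3b - 2`, the graph `H` is nonhamiltonian
and has toughness `a / b`. -/
theorem Hgraph_not_ham_toughness (a b : ℕ) (hba : b < a) (hab : 2 * a + 2 < 3 * b) :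
    ¬ IsHam (Hgraph a b) ∧ HasToughness (Hgraph a b) ((a : ℝ) / b) := by
  refine ⟨fun h => ?_, ⟨by positivity, isTough_Hgraph hba (by omega)⟩, ?_⟩
  · have := le_two_mul_of_isHam_Hgraph h
    omega
  · rintro s ⟨hs, ht⟩
    have hb : 0 < b := by omega
    have hn := le_numComponents_HgraphCut (a := a) (⟨0, hb⟩ : Fin b)
    have h := ht (HgraphCut ⟨0, hb⟩) (by omega)
    rw [card_HgraphCut hba.le] at h
    rw [le_div_iff₀ (by exact_mod_cast hb)]
    exact (mul_le_mul_of_nonneg_left (by exact_mod_cast hn) hs).trans h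
end

section
/- Let P* be the graph obtained from the Petersen graph by replacing each vertex v by a triangle T_v and each edge uv of the Petersen graph by an edge joining a vertex of T_u to a vertex of T_v, in such a way that every vertex of every triangle is incident with exactly one such connecting edge. Then P* is nonhamiltonian and its toughness equals 3/2. -/
open SimpleGraph

/-- The Petersen graph, realized as the Kneser graph `K(5,2)`: vertices are
the 2-element subsets of a 5-element set, adjacent iff disjoint. -/
def petersen : SimpleGraph {s : Finset (Fin 5) // s.card = 2} :=
  SimpleGraph.fromRel fun u v => Disjoint u.1 v.1

/-- The inflation `P*` of the Petersen graph: each vertex `v` is replaced by a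
triangle on `{(v, u) : u ∈ N(v)}`, and each edge `uv` of the Petersen graph is
replaced by the connecting edge `(u, v)(v, u)`; every vertex of every triangle
is incident with exactly one connecting edge. -/
def petersenInflation :
    SimpleGraph {p : {s : Finset (Fin 5) // s.card = 2} ×
      {s : Finset (Fin 5) // s.card = 2} // petersen.Adj p.1 p.2} :=
  SimpleGraph.fromRel fun u v =>
    (u.1.1 = v.1.1) ∨ (u.1.1 = v.1.2 ∧ u.1.2 = v.1.1)

/-- The vertices of the Petersen graph. -/
abbrev PetersenVertex : Type := {s : Finset (Fin 5) // s.card = 2}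

/-- The vertices of the inflation, i.e. the darts of the Petersen graph. -/
abbrev InflationVertex : Type :=
  {p : PetersenVertex × PetersenVertex // petersen.Adj p.1 p.2}

instance : DecidableRel petersen.Adj := fun u v =>
  decidable_of_iff (u ≠ v ∧ (Disjoint u.1 v.1 ∨ Disjoint v.1 u.1))
    (SimpleGraph.fromRel_adj (fun u v : PetersenVertex => Disjoint u.1 v.1) u v).symm

namespace PetersenInflation

/-- The usual drawing of the Petersen graph: `0, …, 4` is the outer cycle, `5, …, 9` the inner
pentagram, and `i` is joined to `i + 5`. -/
def vertex : Fin 10 → PetersenVertex :=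
  ![⟨{0, 1}, rfl⟩, ⟨{2, 3}, rfl⟩, ⟨{0, 4}, rfl⟩, ⟨{1, 2}, rfl⟩, ⟨{3, 4}, rfl⟩,
    ⟨{2, 4}, rfl⟩, ⟨{1, 4}, rfl⟩, ⟨{1, 3}, rfl⟩, ⟨{0, 3}, rfl⟩, ⟨{0, 2}, rfl⟩]

/-- First endpoints of the outer edges, the spokes and the inner edges. -/
def source : Fin 15 → Fin 10 := ![0, 1, 2, 3, 4, 0, 1, 2, 3, 4, 5, 6, 7, 8, 9]

/-- Second endpoints of the outer edges, the spokes and the inner edges. -/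
def target : Fin 15 → Fin 10 := ![1, 2, 3, 4, 0, 5, 6, 7, 8, 9, 7, 8, 9, 5, 6]

/-- The three edges at a vertex. -/
def incident : Fin 10 → Fin 3 → Fin 15 :=
  ![![0, 4, 5], ![0, 1, 6], ![1, 2, 7], ![2, 3, 8], ![3, 4, 9],
    ![5, 10, 13], ![6, 11, 14], ![7, 10, 12], ![8, 11, 13], ![9, 12, 14]]

/-- The six 2-factors of the Petersen graph consist of two 5-cycles each; the vertex set of one
of these 5-cycles. -/
def fiveCycle : Fin 6 → Fin 10 → Bool :=
  ![![true, true, true, true, true, false, false, false, false, false],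
    ![true, true, false, false, true, false, true, false, false, true],
    ![true, true, true, false, false, true, false, true, false, false],
    ![false, true, true, true, false, false, true, false, true, false],
    ![false, false, true, true, true, false, false, true, false, true],
    ![true, false, false, true, true, true, false, false, true, false]]

theorem vertex_injective : Function.Injective vertex := by
  unfold Function.Injective; decide +kernel

theorem vertex_surjective : Function.Surjective vertex := by
  unfold Function.Surjective; decide +kernel

theorem edge_injective :
    Function.Injective fun k => s(vertex (source k), vertex (target k)) := by
  unfold Function.Injective; decide +kernel

theorem adj_edge (k : Fin 15) : petersen.Adj (vertex (source k)) (vertex (target k)) := by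
  revert k; decide +kernel

theorem exists_edge {u v : PetersenVertex} (h : petersen.Adj u v) :
    ∃ k, s(vertex (source k), vertex (target k)) = s(u, v) := by
  obtain ⟨i, rfl⟩ := vertex_surjective u
  obtain ⟨j, rfl⟩ := vertex_surjective v
  revert i j; decide +kernel

theorem incident_injective (i : Fin 10) : Function.Injective (incident i) := by
  unfold Function.Injective; revert i; decide +kernel

theorem exists_incident_iff (i : Fin 10) (k : Fin 15) :
    (∃ a, incident i a = k) ↔ source k = i ∨ target k = i := by
  revert i k; decide +kernel

theorem crossing_card (b : Fin 10 → Bool) (i j : Fin 10) (hi : b i = true) (hj : b j = false) :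
    3 ≤ (Finset.univ.filter fun k => b (source k) ≠ b (target k)).card := by
  have key : ∀ b₀ b₁ b₂ b₃ b₄ b₅ b₆ b₇ b₈ b₉ : Bool,
      (b₀ || b₁ || b₂ || b₃ || b₄ || b₅ || b₆ || b₇ || b₈ || b₉) = true →
      (b₀ && b₁ && b₂ && b₃ && b₄ && b₅ && b₆ && b₇ && b₈ && b₉) = false →
      3 ≤ (b₀ ^^ b₁).toNat + (b₁ ^^ b₂).toNat + (b₂ ^^ b₃).toNat + (b₃ ^^ b₄).toNat + (b₄ ^^ b₀).toNat +
        (b₀ ^^ b₅).toNat + (b₁ ^^ b₆).toNat + (b₂ ^^ b₇).toNat + (b₃ ^^ b₈).toNat + (b₄ ^^ b₉).toNat +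
        (b₅ ^^ b₇).toNat + (b₆ ^^ b₈).toNat + (b₇ ^^ b₉).toNat + (b₈ ^^ b₅).toNat + (b₉ ^^ b₆).toNat := by
    decide +kernel
  have hsum : (Finset.univ.filter fun k => b (source k) ≠ b (target k)).card =
      ∑ k, (b (source k) ^^ b (target k)).toNat := by
    rw [Finset.card_filter]
    refine Finset.sum_congr rfl fun k _ => ?_
    cases b (source k) <;> cases b (target k) <;> rfl
  rw [hsum]
  refine (key (b 0) (b 1) (b 2) (b 3) (b 4) (b 5) (b 6) (b 7) (b 8) (b 9) ?_ ?_).trans_eq ?_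
  · fin_cases i <;> simp at hi <;> simp [hi]
  · fin_cases j <;> simp at hj <;> simp [hj]
  · simp only [Fin.sum_univ_castSucc, Finset.univ_eq_empty, Finset.sum_empty, zero_add]
    rfl

/-- Exactly two of three booleans are true. -/
def exactlyTwo (a b c : Bool) : Bool := (a && b && !c) || (a && !b && c) || (!a && b && c)

/-- Every 2-factor of the Petersen graph leaves the vertex set of some 5-cycle invariant. -/
theorem exists_fiveCycle (q : Fin 15 → Bool)
    (hq : ∀ i, exactlyTwo (q (incident i 0)) (q (incident i 1)) (q (incident i 2))) :
    ∃ c, ∀ k, q k → fiveCycle c (source k) = fiveCycle c (target k) := by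
  have key : ∀ q₀ q₄ q₅, exactlyTwo q₀ q₄ q₅ → ∀ q₁ q₆, exactlyTwo q₀ q₁ q₆ →
      ∀ q₂ q₇, exactlyTwo q₁ q₂ q₇ → ∀ q₃ q₈, exactlyTwo q₂ q₃ q₈ →
      ∀ q₉, exactlyTwo q₃ q₄ q₉ → ∀ q₁₀ q₁₃, exactlyTwo q₅ q₁₀ q₁₃ →
      ∀ q₁₁ q₁₄, exactlyTwo q₆ q₁₁ q₁₄ → ∀ q₁₂, exactlyTwo q₇ q₁₀ q₁₂ →
      exactlyTwo q₈ q₁₁ q₁₃ → exactlyTwo q₉ q₁₂ q₁₄ →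
      ∃ c, ∀ k, ![q₀, q₁, q₂, q₃, q₄, q₅, q₆, q₇, q₈, q₉, q₁₀, q₁₁, q₁₂, q₁₃, q₁₄] k →
        fiveCycle c (source k) = fiveCycle c (target k) := by
    decide +kernel
  have h := key _ _ _ (hq 0) _ _ (hq 1) _ _ (hq 2) _ _ (hq 3) _ (hq 4) _ _ (hq 5) _ _ (hq 6) _
    (hq 7) (hq 8) (hq 9)
  obtain ⟨c, hc⟩ := h
  refine ⟨c, fun k hk => hc k ?_⟩
  rw [← hk]
  fin_cases k <;> rfl

/-- The other end of the connecting edge at `x`. -/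
def swap (x : InflationVertex) : InflationVertex := ⟨(x.1.2, x.1.1), x.2.symm⟩

theorem swap_fst_ne (x : InflationVertex) : (swap x).1.1 ≠ x.1.1 := x.2.ne'

theorem adj_iff {x y : InflationVertex} :
    petersenInflation.Adj x y ↔ x ≠ y ∧ (x.1.1 = y.1.1 ∨ y = swap x) := by
  have h : y = swap x ↔ x.1.1 = y.1.2 ∧ x.1.2 = y.1.1 := by
    rw [Subtype.ext_iff, Prod.ext_iff]
    simp only [swap]
    tauto
  rw [petersenInflation, SimpleGraph.fromRel_adj, h]
  tauto

/-- The vertex of the inflation that represents the `k`-th edge at its end `source k`. -/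
def dart (k : Fin 15) : InflationVertex := ⟨(vertex (source k), vertex (target k)), adj_edge k⟩

theorem exists_dart (x : InflationVertex) : ∃ k, x = dart k ∨ x = swap (dart k) := by
  obtain ⟨k, hk⟩ := exists_edge x.2
  refine ⟨k, ?_⟩
  rcases Sym2.eq_iff.1 hk with ⟨h₁, h₂⟩ | ⟨h₁, h₂⟩
  · exact Or.inl (Subtype.ext (Prod.ext h₁.symm h₂.symm))
  · exact Or.inr (Subtype.ext (Prod.ext h₂.symm h₁.symm))

/-- Three vertices of the inflation at each vertex of the Petersen graph, listed like the
edges there. -/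
def corner (i : Fin 10) (a : Fin 3) : InflationVertex :=
  if source (incident i a) = i then dart (incident i a) else swap (dart (incident i a))

theorem corner_fst (i : Fin 10) (a : Fin 3) : (corner i a).1.1 = vertex i := by
  have := (exists_incident_iff i (incident i a)).1 ⟨a, rfl⟩
  unfold corner
  split_ifs with h
  · simp [dart, h]
  · simp [dart, swap, this.resolve_left h]

theorem corner_injective (i : Fin 10) : Function.Injective (corner i) := by
  intro a b hab
  refine incident_injective i (edge_injective ?_)
  have key : ∀ c, s((corner i c).1.1, (corner i c).1.2) =
      s(vertex (source (incident i c)), vertex (target (incident i c))) := by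
    intro c
    unfold corner
    split_ifs
    · rfl
    · exact Sym2.eq_swap
  simp only [← key, hab]

theorem exists_corner {i : Fin 10} {x : InflationVertex} (hx : x.1.1 = vertex i) :
    ∃ a, x = corner i a := by
  obtain ⟨k, rfl | rfl⟩ := exists_dart x
  · have h : source k = i := vertex_injective hx
    obtain ⟨a, rfl⟩ := (exists_incident_iff i k).2 (Or.inl h)
    exact ⟨a, by rw [corner, if_pos h]⟩
  · have h : target k = i := vertex_injective hx
    obtain ⟨a, rfl⟩ := (exists_incident_iff i k).2 (Or.inr h)
    have h' : source (incident i a) ≠ i := fun h' =>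
      (adj_edge (incident i a)).ne (by rw [h, h'])
    exact ⟨a, by rw [corner, if_neg h']⟩

section Hamiltonian

variable {v : InflationVertex} {p : petersenInflation.Walk v v}

/-- A Hamiltonian cycle leaves every proper nonempty union of triangles along a connecting
edge. -/
theorem exists_crossing (hp : IsHamCycle p) (A : PetersenVertex → Prop) {x y : PetersenVertex}
    (hx : A x) (hy : ¬ A y) :
    ∃ z : InflationVertex, A z.1.1 ∧ ¬ A z.1.2 ∧ p.toSubgraph.Adj z (swap z) := by
  have surj : ∀ u : PetersenVertex, ∃ z : InflationVertex, z.1.1 = u := by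
    intro u
    obtain ⟨i, rfl⟩ := vertex_surjective u
    exact ⟨corner i 0, corner_fst i 0⟩
  obtain ⟨x, rfl⟩ := surj x
  obtain ⟨y, rfl⟩ := surj y
  have hconn : (p.toSubgraph).coe.Preconnected := p.toSubgraph_connected.preconnected.coe
  obtain ⟨w⟩ := hconn ⟨x, p.mem_verts_toSubgraph.2 (hp.2 x)⟩
    ⟨y, p.mem_verts_toSubgraph.2 (hp.2 y)⟩
  obtain ⟨d, -, h₁, h₂⟩ := w.exists_boundary_dart {z | A z.1.1.1} hx hy
  have hd : p.toSubgraph.Adj d.fst d.snd := d.adj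
  rcases (adj_iff.1 hd.adj_sub).2 with h | h
  · exact absurd (h ▸ h₁ : A (d.snd : InflationVertex).1.1) h₂
  · rw [h] at hd
    refine ⟨d.fst, h₁, ?_, hd⟩
    have h₂' : ¬ A (d.snd : InflationVertex).1.1 := h₂
    rwa [h] at h₂'

theorem exactly_two_mem_of_ncard {α : Type*} {N : Set α} {a b c : α} (hab : a ≠ b)
    (hac : a ≠ c) (hbc : b ≠ c) (hN : N ⊆ {a, b, c}) (h : N.ncard = 2) :
    (a ∈ N ∧ b ∈ N ∧ c ∉ N) ∨ (a ∈ N ∧ b ∉ N ∧ c ∈ N) ∨ (a ∉ N ∧ b ∈ N ∧ c ∈ N) := by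
  classical
  have hN' : N = ↑(({a, b, c} : Finset α).filter (· ∈ N)) := by
    ext x
    have := @hN x
    simp at this ⊢
    tauto
  rw [hN', Set.ncard_coe_finset] at h
  by_cases ha : a ∈ N <;> by_cases hb : b ∈ N <;> by_cases hc : c ∈ N <;>
    simp [Finset.filter_insert, Finset.filter_singleton, ha, hb, hc, hab, hac, hbc] at h ⊢

theorem exactly_two_neighbors (hp : IsHamCycle p) {x y z : InflationVertex} (hyz : y ≠ z)
    (hy : y.1.1 = x.1.1) (hz : z.1.1 = x.1.1)
    (h : ∀ t : InflationVertex, t.1.1 = x.1.1 → t = x ∨ t = y ∨ t = z) :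
    let H := p.toSubgraph
    (H.Adj x y ∧ H.Adj x z ∧ ¬ H.Adj x (swap x)) ∨
      (H.Adj x y ∧ ¬ H.Adj x z ∧ H.Adj x (swap x)) ∨
      (¬ H.Adj x y ∧ H.Adj x z ∧ H.Adj x (swap x)) := by
  refine exactly_two_mem_of_ncard (N := p.toSubgraph.neighborSet x) hyz ?_ ?_ ?_
    (hp.1.ncard_neighborSet_toSubgraph_eq_two (hp.2 x))
  · rintro rfl; exact swap_fst_ne x hy
  · rintro rfl; exact swap_fst_ne x hz
  · intro t ht
    have := adj_iff.1 (p.toSubgraph.adj_sub ht)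
    rcases this.2 with h' | h'
    · rcases h t h'.symm with rfl | rfl | rfl
      · exact absurd rfl this.1
      · simp
      · simp
    · simp [h']

theorem exactly_two_connecting (hp : IsHamCycle p) {x y z : InflationVertex} (hxy : x ≠ y)
    (hxz : x ≠ z) (hyz : y ≠ z) (hy : y.1.1 = x.1.1) (hz : z.1.1 = x.1.1)
    (h : ∀ t : InflationVertex, t.1.1 = x.1.1 → t = x ∨ t = y ∨ t = z) :
    let R := fun t => p.toSubgraph.Adj t (swap t)
    (R x ∧ R y ∧ ¬ R z) ∨ (R x ∧ ¬ R y ∧ R z) ∨ (¬ R x ∧ R y ∧ R z) := by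
  have h₁ := exactly_two_neighbors hp hyz hy hz h
  have h₂ := exactly_two_neighbors hp hxz hy.symm (hz.trans hy.symm)
    (fun t ht => by have := h t (ht.trans hy); tauto)
  have h₃ := exactly_two_neighbors hp hxy hz.symm (hy.trans hz.symm)
    (fun t ht => by have := h t (ht.trans hz); tauto)
  obtain ⟨t, ht, -, hR⟩ := exists_crossing hp (· = x.1.1) rfl (swap_fst_ne x)
  have h₄ : p.toSubgraph.Adj x (swap x) ∨ p.toSubgraph.Adj y (swap y) ∨
      p.toSubgraph.Adj z (swap z) := by
    rcases h t ht with rfl | rfl | rfl <;> simp [hR]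
  simp only [p.toSubgraph.adj_comm y x, p.toSubgraph.adj_comm z x,
    p.toSubgraph.adj_comm z y] at h₁ h₂ h₃
  simp only
  tauto

theorem not_isHam : ¬ IsHam petersenInflation := by
  classical
  rintro ⟨v, p, hp⟩
  have hswap : ∀ x, p.toSubgraph.Adj (swap x) (swap (swap x)) ↔ p.toSubgraph.Adj x (swap x) :=
    fun x => p.toSubgraph.adj_comm _ _
  let q : Fin 15 → Bool := fun k => decide (p.toSubgraph.Adj (dart k) (swap (dart k)))
  have hcorner : ∀ i a, p.toSubgraph.Adj (corner i a) (swap (corner i a)) ↔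
      q (incident i a) = true := by
    intro i a
    simp only [q, decide_eq_true_eq]
    unfold corner
    split_ifs
    · rfl
    · exact hswap _
  have hq : ∀ i, exactlyTwo (q (incident i 0)) (q (incident i 1)) (q (incident i 2)) := by
    intro i
    have := exactly_two_connecting hp ((corner_injective i).ne (show (0 : Fin 3) ≠ 1 by decide))
      ((corner_injective i).ne (show (0 : Fin 3) ≠ 2 by decide))
      ((corner_injective i).ne (show (1 : Fin 3) ≠ 2 by decide))
      (by simp only [corner_fst]) (by simp only [corner_fst])
      (fun t ht => by
        obtain ⟨a, rfl⟩ := exists_corner (ht.trans (corner_fst i 0))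
        fin_cases a <;> simp)
    simp only [hcorner] at this
    revert this
    generalize q (incident i 0) = a, q (incident i 1) = b, q (incident i 2) = c
    revert a b c
    decide
  obtain ⟨c, hc⟩ := exists_fiveCycle q hq
  have hproper : ∀ c, (∃ i, fiveCycle c i = true) ∧ ∃ j, ¬ fiveCycle c j = true := by
    decide +kernel
  obtain ⟨⟨i, hi⟩, j, hj⟩ := hproper c
  let A : PetersenVertex → Prop := fun u => ∃ i, vertex i = u ∧ fiveCycle c i = true
  have hA : ∀ i, A (vertex i) ↔ fiveCycle c i = true := fun i =>
    ⟨fun ⟨j, hj, h⟩ => vertex_injective hj ▸ h, fun h => ⟨i, rfl, h⟩⟩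
  obtain ⟨z, h₁, h₂, hz⟩ := exists_crossing hp A ((hA i).2 hi) (mt (hA j).1 hj)
  obtain ⟨k, rfl | rfl⟩ := exists_dart z
  · have hk := hc k (decide_eq_true hz)
    exact h₂ ((hA _).2 (hk ▸ (hA _).1 h₁))
  · have hk := hc k (decide_eq_true ((hswap _).1 hz))
    exact h₂ ((hA _).2 (hk ▸ (hA _).1 h₁))

end Hamiltonian

section Toughness

variable {S : Finset InflationVertex}

/-- `x` is a vertex of the component `c` of the inflation minus `S`. -/
def InComponent (c : (petersenInflation.induce (S : Set InflationVertex)ᶜ).ConnectedComponent)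
    (x : InflationVertex) : Prop :=
  ∃ h : x ∈ (S : Set InflationVertex)ᶜ, SimpleGraph.connectedComponentMk _ ⟨x, h⟩ = c

variable {c d : (petersenInflation.induce (S : Set InflationVertex)ᶜ).ConnectedComponent}
  {x y : InflationVertex}

theorem InComponent.eq (hc : InComponent c x) (hd : InComponent d x) : c = d := by
  obtain ⟨_, rfl⟩ := hc
  obtain ⟨_, rfl⟩ := hd
  rfl

theorem InComponent.of_adj (hc : InComponent c x) (h : petersenInflation.Adj x y)
    (hy : y ∉ S) : InComponent c y := by
  obtain ⟨hx, rfl⟩ := hc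
  refine ⟨by simpa using hy, ?_⟩
  exact SimpleGraph.ConnectedComponent.connectedComponentMk_eq_of_adj
    (SimpleGraph.comap_adj.2 h.symm)

theorem exists_inComponent (c) : ∃ x, InComponent (S := S) c x := by
  induction c using SimpleGraph.ConnectedComponent.ind with
  | h x => exact ⟨x.1, x.2, rfl⟩

theorem InComponent.eq_of_fst_eq (hc : InComponent c x) (hd : InComponent d y)
    (h : x.1.1 = y.1.1) : c = d := by
  by_cases hxy : x = y
  · subst hxy; exact hc.eq hd
  · exact (hc.of_adj (adj_iff.2 ⟨hxy, Or.inl h⟩) (by simpa using hd.1)).eq hd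

/-- `s` has a neighbor in `c`. -/
def Attached (c : (petersenInflation.induce (S : Set InflationVertex)ᶜ).ConnectedComponent)
    (s : InflationVertex) : Prop :=
  ∃ x, InComponent c x ∧ petersenInflation.Adj x s

open Classical in
/-- The inflation is claw-free. -/
theorem card_attached_le_two
    [Fintype (petersenInflation.induce (S : Set InflationVertex)ᶜ).ConnectedComponent]
    (s : InflationVertex) :
    (Finset.univ.filter fun c => Attached (S := S) c s).card ≤ 2 := by
  have hsub : (Finset.univ.filter fun c => Attached (S := S) c s) ⊆
      (Finset.univ.filter fun c => InComponent (S := S) c (swap s)) ∪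
      (Finset.univ.filter fun c => ∃ x, InComponent (S := S) c x ∧ x.1.1 = s.1.1) := by
    intro c hc
    simp only [Finset.mem_filter, Finset.mem_univ, true_and, Finset.mem_union] at hc ⊢
    obtain ⟨x, hx, h⟩ := hc
    rcases (adj_iff.1 h).2 with h | rfl
    · exact Or.inr ⟨x, hx, h⟩
    · exact Or.inl hx
  refine (Finset.card_le_card hsub).trans ((Finset.card_union_le _ _).trans
    (Nat.add_le_add (b := 1) (d := 1) ?_ ?_)) <;>
    rw [Finset.card_le_one] <;>
    simp only [Finset.mem_filter, Finset.mem_univ, true_and]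
  · exact fun c hc d hd => hc.eq hd
  · rintro c ⟨x, hc, hx⟩ d ⟨y, hd, hy⟩
    exact hc.eq_of_fst_eq hd (hx.trans hy.symm)

open Classical in
/-- The inflation is 3-connected. -/
theorem three_le_card_attached (hcd : c ≠ d) :
    3 ≤ (S.filter fun s => Attached c s).card := by
  let b : Fin 10 → Bool := fun i => decide (∃ x, InComponent c x ∧ x.1.1 = vertex i)
  have hb : ∀ {i}, b i = true ↔ ∃ x, InComponent c x ∧ x.1.1 = vertex i := decide_eq_true_iff
  obtain ⟨x, hx⟩ := exists_inComponent c
  obtain ⟨y, hy⟩ := exists_inComponent d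
  obtain ⟨i, hi⟩ := vertex_surjective x.1.1
  obtain ⟨j, hj⟩ := vertex_surjective y.1.1
  have hbj : b j = false := by
    rw [← Bool.not_eq_true, hb]
    rintro ⟨z, hz, hzj⟩
    exact hcd (hz.eq_of_fst_eq hy (hzj.trans hj))
  refine (crossing_card b i j (hb.2 ⟨x, hx, hi.symm⟩) hbj).trans ?_
  have key : ∀ z : InflationVertex, (∃ x, InComponent c x ∧ x.1.1 = z.1.1) →
      (¬ ∃ x, InComponent c x ∧ x.1.1 = z.1.2) →
      ∃ s ∈ S, Attached c s ∧ (s = z ∨ s = swap z) := by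
    rintro z ⟨x, hx, hxz⟩ hz
    have hsw : ¬ InComponent c (swap z) := fun h => hz ⟨_, h, rfl⟩
    by_cases h : InComponent c z
    · have hadj : petersenInflation.Adj z (swap z) :=
        adj_iff.2 ⟨fun h => swap_fst_ne z (by rw [← h]), Or.inr rfl⟩
      exact ⟨swap z, by_contra fun hS => hsw (h.of_adj hadj hS), ⟨z, h, hadj⟩, Or.inr rfl⟩
    · have hadj : petersenInflation.Adj x z :=
        adj_iff.2 ⟨fun h' => h (h' ▸ hx), Or.inl hxz⟩
      exact ⟨z, by_contra fun hS => h (hx.of_adj hadj hS), ⟨x, hx, hadj⟩, Or.inl rfl⟩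
  have key' : ∀ k, b (source k) ≠ b (target k) →
      ∃ s ∈ S, Attached c s ∧ (s = dart k ∨ s = swap (dart k)) := by
    intro k hk
    cases h₁ : b (source k) <;> cases h₂ : b (target k) <;> simp only [h₁, h₂, ne_eq,
      not_true_eq_false] at hk
    · obtain ⟨s, hs, ha, h⟩ := key (swap (dart k)) (hb.1 h₂) (by
        rw [← Bool.not_eq_true, hb] at h₁; exact h₁)
      exact ⟨s, hs, ha, h.symm⟩
    · exact key (dart k) (hb.1 h₁) (by rw [← Bool.not_eq_true, hb] at h₂; exact h₂)
  have : Nonempty InflationVertex := ⟨x⟩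
  choose! f hfS hfa hf using key'
  refine Finset.card_le_card_of_injOn f (fun k hk => ?_) (fun k hk l hl hkl => ?_)
  · simp only [Finset.coe_filter, Finset.mem_univ, true_and, Set.mem_ofPred_eq] at hk
    simpa using ⟨hfS k hk, hfa k hk⟩
  · simp only [Finset.coe_filter, Finset.mem_univ, true_and, Set.mem_ofPred_eq] at hk hl
    have hs : ∀ k, b (source k) ≠ b (target k) →
        s((f k).1.1, (f k).1.2) = s(vertex (source k), vertex (target k)) := by
      intro k hk
      rcases hf k hk with h | h <;> rw [h]
      · rfl
      · exact Sym2.eq_swap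
    exact edge_injective (by simp only [← hs k hk, ← hs l hl, hkl])

theorem isTough : IsTough (3 / 2) petersenInflation := by
  classical
  intro S hS
  have : Fintype (petersenInflation.induce (S : Set InflationVertex)ᶜ).ConnectedComponent :=
    Fintype.ofFinite _
  unfold numComponents at hS ⊢
  rw [Nat.card_eq_fintype_card] at hS ⊢
  have hnt := Fintype.one_lt_card_iff_nontrivial.1 hS
  have h := Finset.card_mul_le_card_mul (s := Finset.univ) (t := S) (m := 3) (n := 2)
    (fun c s => Attached (S := S) c s)
    (fun c _ => (exists_ne c).elim fun d hd => three_le_card_attached hd.symm)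
    (fun s _ => card_attached_le_two s)
  rw [Finset.card_univ] at h
  have h' : (Fintype.card
      (petersenInflation.induce (S : Set InflationVertex)ᶜ).ConnectedComponent : ℝ) * 3 ≤
      (S.card : ℝ) * 2 := by exact_mod_cast h
  linarith

theorem le_of_isTough {t : ℝ} (ht₀ : 0 ≤ t) (ht : IsTough t petersenInflation) : t ≤ 3 / 2 := by
  classical
  let x := corner 0 0
  let y := corner 2 0
  let S : Finset InflationVertex := {corner 0 1, corner 0 2, swap x}
  have hdisj : x ∉ S ∧ y ∉ S ∧ x ≠ y := by decide +kernel
  obtain ⟨hxS, hyS, hxy⟩ := hdisj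
  have hnbr : ∀ z, petersenInflation.Adj x z → z ∈ S := by
    intro z hz
    obtain ⟨hne, h | rfl⟩ := adj_iff.1 hz
    · obtain ⟨a, rfl⟩ := exists_corner (h.symm.trans (corner_fst 0 0))
      fin_cases a
      · exact absurd rfl hne
      · simp [S]
      · simp [S]
    · simp [S]
  have hlt : 1 < numComponents petersenInflation (S : Set InflationVertex) := by
    unfold numComponents
    rw [Finite.one_lt_card_iff_nontrivial]
    refine ⟨SimpleGraph.connectedComponentMk _ ⟨x, by simpa using hxS⟩,
      SimpleGraph.connectedComponentMk _ ⟨y, by simpa using hyS⟩, fun h => ?_⟩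
    obtain ⟨w⟩ := SimpleGraph.ConnectedComponent.exact h
    have hadj := w.adj_snd (SimpleGraph.Walk.not_nil_of_ne fun h => hxy (congrArg Subtype.val h))
    exact w.snd.2 (hnbr _ (SimpleGraph.comap_adj.1 hadj))
  have h := ht S hlt
  have hcard : (S.card : ℝ) ≤ 3 := by exact_mod_cast Finset.card_le_three
  have h2 : (2 : ℝ) ≤ numComponents petersenInflation (S : Set InflationVertex) := by
    exact_mod_cast hlt
  nlinarith

end Toughness

end PetersenInflation

/-- `P*` is nonhamiltonian and has toughness `3/2`. -/
theorem petersenInflation_not_ham_toughness :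
    ¬ IsHam petersenInflation ∧ HasToughness petersenInflation (3 / 2) :=
  ⟨PetersenInflation.not_isHam, ⟨by norm_num, PetersenInflation.isTough⟩,
    fun _ ht => PetersenInflation.le_of_isTough ht.1 ht.2⟩
end

section
/- For every subset S of the vertex set of L⁽³⁾, if ω′ denotes the number of connected components of L⁽³⁾∖S that contain neither x = w₁ nor y = w₅, then ω′ ≤ 3 and |S| ≥ (4/3)·ω′. -/
open SimpleGraph

/-- The number of connected components of the subgraph of `G` induced on the
complement of `S` that contain neither `x` nor `y`. -/
noncomputable def numCompAvoiding {V : Type} (G : SimpleGraph V) (S : Set V)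
    (x y : V) : ℕ :=
  Nat.card {c : (G.induce Sᶜ).ConnectedComponent //
    ∀ v : ↥Sᶜ, (G.induce Sᶜ).connectedComponentMk v = c → (v : V) ≠ x ∧ (v : V) ≠ y}

/-- The neighbours of each vertex of `L3`. -/
def L3Neighbors : Fin 9 → List (Fin 9) :=
  ![[1, 7], [0, 2, 3, 7], [1, 3], [1, 2, 4, 5, 8], [3, 5], [3, 4, 6, 7, 8], [5, 7], [0, 1, 5, 6],
    [3, 5]]

theorem L3_adj_of_mem_neighbors : ∀ {u v : Fin 9}, v ∈ L3Neighbors u → L3.Adj u v := by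
  have key : ∀ u v : Fin 9, v ∈ L3Neighbors u → s(u, v) ∈ ({s(0,1), s(1,2), s(2,3), s(3,4),
      s(4,5), s(5,6), s(6,7), s(7,0), s(1,3), s(3,5), s(5,7), s(1,7), s(3,8), s(5,8)} :
      Finset (Sym2 (Fin 9))) ∧ u ≠ v := by decide +kernel
  intro u v h
  obtain ⟨hmem, hne⟩ := key u v h
  rw [L3, SimpleGraph.fromEdgeSet_adj]
  exact ⟨by simpa using hmem, hne⟩

/-- Whether `L3` has a walk of length at most `n` from `u` to `w` whose vertices after `u` are
not removed. -/
def L3ReachesWithin (removed : Fin 9 → Bool) (w : Fin 9) : ℕ → Fin 9 → Bool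
  | 0, u => u == w
  | n + 1, u => u == w ||
      (L3Neighbors u).any fun v => !removed v && L3ReachesWithin removed w n v

theorem reachable_of_L3ReachesWithin {S : Set (Fin 9)} {removed : Fin 9 → Bool}
    (hS : ∀ v, removed v = false → v ∈ Sᶜ) {w : Fin 9} (hw : w ∈ Sᶜ) (n : ℕ) {u : Fin 9}
    (hu : u ∈ Sᶜ) (h : L3ReachesWithin removed w n u = true) :
    (L3.induce Sᶜ).Reachable ⟨u, hu⟩ ⟨w, hw⟩ := by
  induction n generalizing u with
  | zero =>
    obtain rfl : u = w := by simpa [L3ReachesWithin] using h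
    rfl
  | succ n ih =>
    simp only [L3ReachesWithin, Bool.or_eq_true, beq_iff_eq, List.any_eq_true, Bool.and_eq_true,
      Bool.not_eq_true'] at h
    obtain rfl | ⟨v, hv, hvS, hvw⟩ := h
    · rfl
    · have hadj : (L3.induce Sᶜ).Adj ⟨u, hu⟩ ⟨v, hS v hvS⟩ := L3_adj_of_mem_neighbors hv
      exact hadj.reachable.trans (ih (hS v hvS) hvw)

/-- Whether `v` is not removed, and neither `0`, nor `4`, nor a smaller vertex, unless removed,
is reached from `v` within four steps. -/
def L3IsLeast (removed : Fin 9 → Bool) (v : Fin 9) : Bool :=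
  !removed v && (List.finRange 9).all fun w =>
    removed w || !(w == 0 || w == 4 || decide (w < v)) || !L3ReachesWithin removed w 4 v

theorem numCompAvoiding_L3_le (S : Finset (Fin 9)) :
    numCompAvoiding L3 ↑S 0 4 ≤
      (Finset.univ.filter fun v => L3IsLeast (fun u => decide (u ∈ S)) v = true).card := by
  have hleast : ∀ c : (L3.induce (S : Set (Fin 9))ᶜ).ConnectedComponent,
      ∃ v : ↥(S : Set (Fin 9))ᶜ, (L3.induce _).connectedComponentMk v = c ∧
        ∀ w, (L3.induce _).connectedComponentMk w = c → v ≤ w := by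
    intro c
    obtain ⟨v, hv, hmin⟩ := Set.exists_min_image {v | (L3.induce _).connectedComponentMk v = c} id
      (Set.toFinite _) c.exists_rep
    exact ⟨v, hv, hmin⟩
  choose rep hrep hmin using hleast
  have hremoved : ∀ v, decide (v ∈ S) = false → v ∈ (S : Set (Fin 9))ᶜ := by simp
  rw [numCompAvoiding, ← Fintype.card_coe, ← Nat.card_eq_fintype_card]
  refine Nat.card_le_card_of_injective (fun c => ⟨rep c.1, ?_⟩) fun c d hcd => ?_
  · simp only [Finset.mem_filter, Finset.mem_univ, true_and, L3IsLeast, Bool.and_eq_true,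
      List.all_eq_true]
    have hrepS : (rep c.1 : Fin 9) ∉ S := (rep c.1).2
    refine ⟨by simpa using hrepS, fun w _ => ?_⟩
    by_contra hw
    simp only [Bool.or_eq_true, Bool.not_eq_true', decide_eq_true_eq, not_or,
      Bool.not_eq_false, beq_iff_eq] at hw
    obtain ⟨⟨hwS, hw⟩, hreach⟩ := hw
    have hwS' : w ∈ (S : Set (Fin 9))ᶜ := by simpa using hwS
    have hwc : (L3.induce _).connectedComponentMk ⟨w, hwS'⟩ = c.1 := by
      rw [← hrep c.1, SimpleGraph.ConnectedComponent.eq]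
      exact (reachable_of_L3ReachesWithin hremoved hwS' 4 (rep c.1).2 hreach).symm
    have havoid := c.2 _ hwc
    have hle : (rep c.1 : Fin 9) ≤ w := hmin c.1 _ hwc
    obtain (h0 | h4) | hlt := hw
    · exact havoid.1 h0
    · exact havoid.2 h4
    · exact hle.not_gt hlt
  · have : rep c.1 = rep d.1 := Subtype.ext (Subtype.mk.inj hcd)
    exact Subtype.ext (by rw [← hrep c.1, this, hrep])

theorem card_L3IsLeast_le (S : Finset (Fin 9)) :
    (Finset.univ.filter fun v => L3IsLeast (fun u => decide (u ∈ S)) v = true).card ≤ 3 ∧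
      4 * (Finset.univ.filter fun v => L3IsLeast (fun u => decide (u ∈ S)) v = true).card ≤
        3 * S.card := by
  have key : ∀ b₀ b₁ b₂ b₃ b₄ b₅ b₆ b₇ b₈ : Bool,
      let removed : Fin 9 → Bool := ![b₀, b₁, b₂, b₃, b₄, b₅, b₆, b₇, b₈]
      (Finset.univ.filter fun v => L3IsLeast removed v = true).card ≤ 3 ∧
        4 * (Finset.univ.filter fun v => L3IsLeast removed v = true).card ≤
          3 * (Finset.univ.filter fun v => removed v = true).card := by
    decide +kernel
  have hfun : (fun u => decide (u ∈ S)) = ![decide (0 ∈ S), decide (1 ∈ S), decide (2 ∈ S),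
      decide (3 ∈ S), decide (4 ∈ S), decide (5 ∈ S), decide (6 ∈ S), decide (7 ∈ S),
      decide (8 ∈ S)] := by
    funext u
    fin_cases u <;> rfl
  have hcard : S = Finset.univ.filter fun v => (fun u => decide (u ∈ S)) v = true := by
    ext; simp
  have h := key (decide (0 ∈ S)) (decide (1 ∈ S)) (decide (2 ∈ S)) (decide (3 ∈ S))
    (decide (4 ∈ S)) (decide (5 ∈ S)) (decide (6 ∈ S)) (decide (7 ∈ S)) (decide (8 ∈ S))
  simp only [← hfun] at h
  rwa [← hcard] at h

/-- For every vertex subset `S` of `L⁽³⁾`, the number `ω'` of components of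
`L⁽³⁾ \ S` containing neither `x = w₁` nor `y = w₅` satisfies `ω' ≤ 3` and
`|S| ≥ (4/3)ω'`. -/
theorem L3_components_bound (S : Finset (Fin 9)) :
    numCompAvoiding L3 ↑S 0 4 ≤ 3 ∧
      (4 / 3 : ℝ) * (numCompAvoiding L3 ↑S 0 4 : ℝ) ≤ (S.card : ℝ) := by
  obtain ⟨h3, h4⟩ := card_L3IsLeast_le S
  have h := numCompAvoiding_L3_le S
  refine ⟨h.trans h3, ?_⟩
  have h4' : 4 * (numCompAvoiding L3 ↑S 0 4 : ℝ) ≤ 3 * (S.card : ℝ) := by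
    exact_mod_cast (Nat.mul_le_mul_left 4 h).trans h4
  linarith
end
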